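/- Let k ≥ 1, let ε ≥ 0 satisfy ν e_j ≤ ε for all 1 ≤ j ≤ k, and assume the double series Σ_{i=0}^∞ Σ_{j=0}^∞ γ^{i+jm} c(i+jm) converges. Then μ(v_{π*} − v_{k,m}) ≤ (Σ_{i=0}^∞ Σ_{j=0}^∞ γ^{i+jm} c(i+jm)) ε + 2 γ^k Vmax; that is, μ(v_{π*} − v_{k,m}) ≤ C^{(2,m,0)}/((1−γ)(1−γ^m)) · ε + 2 γ^k Vmax, where C^{(2,m,0)} = (1−γ)(1−γ^m) Σ_{i,j≥0} γ^{i+jm} c(i+jm). -/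

import Mathlib

open Finset Matrix

noncomputable section

/-- Transition matrix of a deterministic stationary policy. -/
def polMat {S A : Type*} (P : S → A → S → ℝ) (π : S → A) : Matrix S S ℝ :=
  Matrix.of fun s s' => P s (π s) s'

/-- Bellman operator `T_π v = r + γ P_π v` of a deterministic stationary policy. -/
def bOp {S A : Type*} [Fintype S] (P : S → A → S → ℝ) (γ : ℝ) (r : S → ℝ)
    (π : S → A) (v : S → ℝ) : S → ℝ :=
  fun s => r s + γ * ∑ s' : S, P s (π s) s' * v s'

/-- `errOf P γ r v π = max_{π'} T_{π'} v − T_π v` (componentwise maximum over all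
deterministic stationary policies `π'`). -/
def errOf {S A : Type*} [Fintype S] [Fintype A] [DecidableEq S] [Nonempty A]
    (P : S → A → S → ℝ) (γ : ℝ) (r : S → ℝ) (v : S → ℝ) (π : S → A) : S → ℝ :=
  fun s => (Finset.univ.sup' Finset.univ_nonempty fun π' : S → A => bOp P γ r π' v s)
    - bOp P γ r π v s

/-- Values of the PSDP∞ non-stationary policies: `vSig P γ r πseq k = v_{σ_k}
= T_{π_k} T_{π_{k-1}} ⋯ T_{π_1} r` (so `vSig P γ r πseq 0 = r`). -/
def vSig {S A : Type*} [Fintype S] (P : S → A → S → ℝ) (γ : ℝ) (r : S → ℝ)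
    (πseq : ℕ → S → A) : ℕ → S → ℝ
  | 0 => r
  | k+1 => bOp P γ r (πseq (k+1)) (vSig P γ r πseq k)


/-- The composed NSPI operator
`nsRun P γ r πseq j m v = T_{π_j} T_{π_{j−1}} ⋯ T_{π_{j−m+1}} v` (identity for `m = 0`). -/
def nsRun {S A : Type*} [Fintype S] (P : S → A → S → ℝ) (γ : ℝ) (r : S → ℝ)
    (πseq : ℤ → S → A) : ℤ → ℕ → (S → ℝ) → (S → ℝ)
  | _, 0, v => v
  | j, m+1, v => bOp P γ r (πseq j) (nsRun P γ r πseq (j-1) m v)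

/-- `gamMat P γ πseq j m = Γ_{j,m} = (γP_{π_j})(γP_{π_{j−1}})⋯(γP_{π_{j−m+1}})`. -/
def gamMat {S A : Type*} [Fintype S] [DecidableEq S]
    (P : S → A → S → ℝ) (γ : ℝ) (πseq : ℤ → S → A) (j : ℤ) (m : ℕ) : Matrix S S ℝ :=
  ((List.range m).map fun i => γ • polMat P (πseq (j - (i : ℤ)))).prod

/-- Product of the transition matrices of a list of policies. -/
def polProd {S A : Type*} [Fintype S] [DecidableEq S] (P : S → A → S → ℝ)
    (L : List (S → A)) : Matrix S S ℝ :=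
  (L.map (polMat P)).prod

section

variable {S A : Type*} [Fintype S] {P : S → A → S → ℝ} {γ Rmax Vmax : ℝ} {r : S → ℝ}

lemma bOp_eq (π : S → A) (v : S → ℝ) : bOp P γ r π v = r + γ • (polMat P π *ᵥ v) := by
  ext s
  simp [bOp, polMat, Matrix.mulVec, dotProduct]

lemma polMat_mulVec_mono (hP0 : ∀ s a s', 0 ≤ P s a s') (π : S → A) {x y : S → ℝ}
    (h : x ≤ y) : polMat P π *ᵥ x ≤ polMat P π *ᵥ y :=
  fun _ => Finset.sum_le_sum fun s' _ => mul_le_mul_of_nonneg_left (h s') (hP0 _ _ _)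

lemma polMat_mulVec_const (hP1 : ∀ s a, ∑ s' : S, P s a s' = 1) (π : S → A) (a : ℝ) :
    (polMat P π *ᵥ fun _ => a) = fun _ => a := by
  ext s
  simp [polMat, Matrix.mulVec, dotProduct, ← Finset.sum_mul, hP1]

lemma bOp_sub (π : S → A) (v w : S → ℝ) :
    bOp P γ r π v - bOp P γ r π w = γ • (polMat P π *ᵥ (v - w)) := by
  rw [bOp_eq, bOp_eq, Matrix.mulVec_sub, smul_sub]
  abel

lemma abs_bOp_le (hP0 : ∀ s a s', 0 ≤ P s a s') (hP1 : ∀ s a, ∑ s' : S, P s a s' = 1)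
    (hγ0 : 0 < γ) (hr : ∀ s, |r s| ≤ Rmax) (π : S → A) {v : S → ℝ} {b : ℝ}
    (hv : ∀ s, |v s| ≤ b) (s : S) : |bOp P γ r π v s| ≤ Rmax + γ * b := by
  have h : |∑ s' : S, P s (π s) s' * v s'| ≤ b :=
    calc |∑ s' : S, P s (π s) s' * v s'| ≤ ∑ s' : S, |P s (π s) s' * v s'| :=
          Finset.abs_sum_le_sum_abs _ _
      _ ≤ ∑ s' : S, P s (π s) s' * b := Finset.sum_le_sum fun s' _ => by
          rw [abs_mul, abs_of_nonneg (hP0 _ _ _)]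
          exact mul_le_mul_of_nonneg_left (hv s') (hP0 _ _ _)
      _ = b := by rw [← Finset.sum_mul, hP1, one_mul]
  calc |bOp P γ r π v s| ≤ |r s| + |γ * ∑ s' : S, P s (π s) s' * v s'| := abs_add_le _ _
    _ ≤ Rmax + γ * b := by
      rw [abs_mul, abs_of_pos hγ0]
      exact add_le_add (hr s) (mul_le_mul_of_nonneg_left h hγ0.le)

lemma abs_nsRun_le (hP0 : ∀ s a s', 0 ≤ P s a s') (hP1 : ∀ s a, ∑ s' : S, P s a s' = 1)
    (hγ0 : 0 < γ) (hr : ∀ s, |r s| ≤ Rmax) (hV : Rmax + γ * Vmax = Vmax)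
    (πseq : ℤ → S → A) {v : S → ℝ} {d : ℝ} (hv : ∀ s, |v s| ≤ Vmax + d) (m : ℕ) :
    ∀ (j : ℤ) (s : S), |nsRun P γ r πseq j m v s| ≤ Vmax + γ ^ m * d := by
  induction m with
  | zero => intro j s; simpa [nsRun] using hv s
  | succ m ih =>
    intro j s
    refine (abs_bOp_le hP0 hP1 hγ0 hr _ (ih (j - 1)) s).trans (le_of_eq ?_)
    linear_combination hV

lemma abs_fixedPoint_nsRun_le [Nonempty S] (hP0 : ∀ s a s', 0 ≤ P s a s')
    (hP1 : ∀ s a, ∑ s' : S, P s a s' = 1) (hγ0 : 0 < γ) (hγ1 : γ < 1)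
    (hr : ∀ s, |r s| ≤ Rmax) (hV : Rmax + γ * Vmax = Vmax) (πseq : ℤ → S → A)
    {m : ℕ} (hm : 1 ≤ m) {v : S → ℝ} {j : ℤ} (hv : nsRun P γ r πseq j m v = v) (s : S) :
    |v s| ≤ Vmax := by
  obtain ⟨t, ht⟩ := Finite.exists_max fun s => |v s|
  have h := abs_nsRun_le hP0 hP1 hγ0 hr hV πseq (v := v) (d := |v t| - Vmax)
    (fun s => by linarith [ht s]) m j t
  rw [hv] at h
  have hlt : γ ^ m < 1 := pow_lt_one₀ hγ0.le hγ1 (by omega)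
  have : |v t| ≤ Vmax := by
    by_contra! hcon
    nlinarith
  exact (ht s).trans this

lemma nsRun_succ (πseq : ℤ → S → A) (m : ℕ) (j : ℤ) (v : S → ℝ) :
    nsRun P γ r πseq j (m + 1) v = nsRun P γ r πseq j m (bOp P γ r (πseq (j - m)) v) := by
  induction m generalizing j with
  | zero => simp [nsRun]
  | succ m ih =>
    rw [nsRun, ih, nsRun]
    congr 4
    push_cast
    ring

variable [DecidableEq S]

lemma polProd_append (L L' : List (S → A)) :
    polProd P (L ++ L') = polProd P L * polProd P L' := by
  simp [polProd]

lemma polProd_mulVec_mono (hP0 : ∀ s a s', 0 ≤ P s a s') (L : List (S → A)) {x y : S → ℝ}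
    (h : x ≤ y) : polProd P L *ᵥ x ≤ polProd P L *ᵥ y := by
  induction L with
  | nil => simpa [polProd] using h
  | cons π L ih =>
    simp only [polProd, List.map_cons, List.prod_cons, ← Matrix.mulVec_mulVec] at ih ⊢
    exact polMat_mulVec_mono hP0 π ih

lemma polProd_mulVec_const (hP1 : ∀ s a, ∑ s' : S, P s a s' = 1) (L : List (S → A)) (a : ℝ) :
    (polProd P L *ᵥ fun _ => a) = fun _ => a := by
  induction L with
  | nil => simp [polProd]
  | cons π L ih =>
    simp only [polProd, List.map_cons, List.prod_cons, ← Matrix.mulVec_mulVec] at ih ⊢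
    rw [ih, polMat_mulVec_const hP1]

lemma nsRun_sub (πseq : ℤ → S → A) (m : ℕ) (j : ℤ) :
    ∃ L : List (S → A), L.length = m ∧ ∀ v w : S → ℝ,
      nsRun P γ r πseq j m v - nsRun P γ r πseq j m w = γ ^ m • (polProd P L *ᵥ (v - w)) := by
  induction m generalizing j with
  | zero => exact ⟨[], rfl, fun v w => by simp [nsRun, polProd]⟩
  | succ m ih =>
    obtain ⟨L, hL, h⟩ := ih (j - 1)
    refine ⟨πseq j :: L, by simp [hL], fun v w => ?_⟩
    simp only [nsRun, bOp_sub, h, polProd, List.map_cons, List.prod_cons,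
      Matrix.mulVec_smul, smul_smul, Matrix.mulVec_mulVec, pow_succ']

lemma dotProduct_polProd_mono (hP0 : ∀ s a s', 0 ≤ P s a s') {μ : S → ℝ}
    (hμ0 : ∀ s, 0 ≤ μ s) (L : List (S → A)) {x y : S → ℝ} (h : x ≤ y) :
    μ ⬝ᵥ (polProd P L *ᵥ x) ≤ μ ⬝ᵥ (polProd P L *ᵥ y) :=
  Finset.sum_le_sum fun s _ =>
    mul_le_mul_of_nonneg_left (polProd_mulVec_mono hP0 L h s) (hμ0 s)

lemma dotProduct_polProd_const (hP1 : ∀ s a, ∑ s' : S, P s a s' = 1) {μ : S → ℝ}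
    (hμ1 : ∑ s : S, μ s = 1) (L : List (S → A)) (a : ℝ) :
    (μ ⬝ᵥ (polProd P L *ᵥ fun _ => a)) = a := by
  rw [polProd_mulVec_const hP1]
  simp [dotProduct, ← Finset.sum_mul, hμ1]

lemma dotProduct_polProd_le [Nonempty A] {μ ν : S → ℝ} {c : ℕ → ℝ}
    (hc : ∀ (i : ℕ) (πs : ℕ → S → A) (s : S),
      Matrix.vecMul μ (((List.range i).map fun t => polMat P (πs t)).prod) s ≤ c i * ν s)
    (L : List (S → A)) {x : S → ℝ} (hx : 0 ≤ x) :
    μ ⬝ᵥ (polProd P L *ᵥ x) ≤ c L.length * (ν ⬝ᵥ x) := by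
  have hL : ((List.range L.length).map fun t =>
      polMat P (L.getD t fun _ => Classical.arbitrary A)) = L.map (polMat P) := by
    apply List.ext_getElem
    · simp
    · intro i h₁ h₂
      simp at h₁
      simp [h₁]
  rw [Matrix.dotProduct_mulVec, dotProduct, dotProduct, Finset.mul_sum]
  refine Finset.sum_le_sum fun s _ => ?_
  rw [← mul_assoc]
  have h := hc L.length (fun t => L.getD t fun _ => Classical.arbitrary A) s
  rw [hL] at h
  exact mul_le_mul_of_nonneg_right h (hx s)

lemma dotProduct_le_of_le_add_smul [Nonempty A]
    (hP0 : ∀ s a s', 0 ≤ P s a s') (hP1 : ∀ s a, ∑ s' : S, P s a s' = 1)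
    (hγ0 : 0 < γ) (hγ1 : γ < 1) {μ ν : S → ℝ} (hμ0 : ∀ s, 0 ≤ μ s)
    (hμ1 : ∑ s : S, μ s = 1) {c : ℕ → ℝ} (hc0 : ∀ i, 0 ≤ c i)
    (hc : ∀ (i : ℕ) (πs : ℕ → S → A) (s : S),
      Matrix.vecMul μ (((List.range i).map fun t => polMat P (πs t)).prod) s ≤ c i * ν s)
    {m : ℕ} (hm : 1 ≤ m) {ε : ℝ} {e y : S → ℝ} (he0 : 0 ≤ e)
    (he : ν ⬝ᵥ e ≤ ε) {L' : List (S → A)} (hL' : L'.length = m)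
    (hy : y ≤ e + γ ^ m • (polProd P L' *ᵥ y)) (L : List (S → A))
    (hsum : Summable fun j : ℕ => γ ^ (L.length + j * m) * c (L.length + j * m)) :
    γ ^ L.length * (μ ⬝ᵥ (polProd P L *ᵥ y)) ≤
      (∑' j : ℕ, γ ^ (L.length + j * m) * c (L.length + j * m)) * ε := by
  obtain ⟨M, hM⟩ : ∃ M : ℝ, y ≤ fun _ => M := by
    obtain ⟨M, hM⟩ := (Set.finite_range y).bddAbove
    exact ⟨M, fun s => hM ⟨s, rfl⟩⟩
  have key : ∀ (N : ℕ) (L : List (S → A)), γ ^ L.length * (μ ⬝ᵥ (polProd P L *ᵥ y)) ≤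
      (∑ j ∈ Finset.range N, γ ^ (L.length + j * m) * c (L.length + j * m)) * ε
        + γ ^ (L.length + N * m) * M := by
    intro N
    induction N with
    | zero =>
      intro L
      have h := dotProduct_polProd_mono hP0 hμ0 L hM
      rw [dotProduct_polProd_const hP1 hμ1] at h
      simpa using mul_le_mul_of_nonneg_left h (by positivity : 0 ≤ γ ^ L.length)
    | succ N ih =>
      intro L
      have h := dotProduct_polProd_mono hP0 hμ0 L hy
      rw [Matrix.mulVec_add, dotProduct_add, Matrix.mulVec_smul, dotProduct_smul,
        Matrix.mulVec_mulVec, ← polProd_append, smul_eq_mul] at h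
      have h₁ : μ ⬝ᵥ (polProd P L *ᵥ e) ≤ c L.length * ε :=
        (dotProduct_polProd_le hc L he0).trans (mul_le_mul_of_nonneg_left he (hc0 _))
      have h₂ := ih (L ++ L')
      rw [List.length_append, hL'] at h₂
      have h₃ := mul_le_mul_of_nonneg_left (h.trans (add_le_add_left h₁ _))
        (by positivity : 0 ≤ γ ^ L.length)
      rw [Finset.sum_range_succ']
      have h₄ : ∀ j, L.length + (j + 1) * m = L.length + m + j * m := fun j => by ring
      simp only [h₄, zero_mul, add_zero]
      rw [pow_add γ L.length m] at h₂
      linarith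
  have hpow : Filter.Tendsto (fun N : ℕ => γ ^ (L.length + N * m) * M) Filter.atTop (nhds 0) := by
    have h : Filter.Tendsto (fun N : ℕ => L.length + N * m) Filter.atTop Filter.atTop :=
      Filter.tendsto_atTop_mono (fun N =>
        (Nat.le_mul_of_pos_right N hm).trans (Nat.le_add_left _ _)) Filter.tendsto_id
    simpa using ((tendsto_pow_atTop_nhds_zero_of_lt_one hγ0.le hγ1).comp h).mul_const M
  have hlim := (hsum.hasSum.tendsto_sum_nat.mul_const ε).add hpow
  rw [add_zero] at hlim
  exact ge_of_tendsto' hlim fun N => key N L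

variable [Fintype A] [Nonempty A]

lemma bOp_le_add_errOf (v : S → ℝ) (π π' : S → A) :
    bOp P γ r π' v ≤ bOp P γ r π v + errOf P γ r v π := by
  intro s
  simp only [errOf, Pi.add_apply, add_sub_cancel]
  exact Finset.le_sup' (fun π' : S → A => bOp P γ r π' v s) (Finset.mem_univ π')

lemma errOf_nonneg (v : S → ℝ) (π : S → A) : 0 ≤ errOf P γ r v π := by
  simpa using bOp_le_add_errOf (P := P) (γ := γ) (r := r) v π π

/-- One-step gap of the non-stationary iteration: with `y = T_{π_j} v - w + e_j`, where `v`, `w`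
are consecutive periodic values, one has `y ≤ e_j + Γ_{j,m} y`. -/
lemma nsRun_gap_le (hP0 : ∀ s a s', 0 ≤ P s a s') (hγ0 : 0 < γ) (πseq : ℤ → S → A) (m : ℕ)
    (j : ℤ) {v w : S → ℝ} (hv : nsRun P γ r πseq (j - 1) m v = v)
    (hw : nsRun P γ r πseq j m w = w) :
    ∃ L : List (S → A), L.length = m ∧
      bOp P γ r (πseq j) v - w + errOf P γ r v (πseq j) ≤ errOf P γ r v (πseq j) +
        γ ^ m • (polProd P L *ᵥ (bOp P γ r (πseq j) v - w + errOf P γ r v (πseq j))) := by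
  obtain ⟨L, hL, h⟩ := nsRun_sub (P := P) (γ := γ) (r := r) πseq m j
  refine ⟨L, hL, ?_⟩
  have hstep : bOp P γ r (πseq j) v - w
      = γ ^ m • (polProd P L *ᵥ (bOp P γ r (πseq (j - m)) v - w)) := by
    rw [← h, ← nsRun_succ, hw, nsRun, hv]
  have hle : bOp P γ r (πseq (j - m)) v - w
      ≤ bOp P γ r (πseq j) v - w + errOf P γ r v (πseq j) := by
    rw [sub_add_eq_add_sub]
    exact sub_le_sub_right (bOp_le_add_errOf v _ _) w
  nth_rw 1 [add_comm]
  refine add_le_add_right (hstep.le.trans ?_) _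
  exact smul_le_smul_of_nonneg_left (polProd_mulVec_mono hP0 L hle) (by positivity)

end

/-- for NSPI(m), if `ν e_j ≤ ε` for `1 ≤ j ≤ k` and the double series
`Σ_{i,j≥0} γ^{i+jm} c(i+jm)` converges, then
`μ(v_{π*} − v_{k,m}) ≤ (Σ_{i,j≥0} γ^{i+jm} c(i+jm)) ε + 2 γ^k Vmax`
(that is, `μ(v_{π*} − v_{k,m}) ≤ C^{(2,m,0)}/((1−γ)(1−γ^m)) ε + 2 γ^k Vmax`). -/
theorem stmt6
    {S A : Type*} [Fintype S] [Fintype A] [DecidableEq S] [Nonempty S] [Nonempty A]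
    (P : S → A → S → ℝ) (hP0 : ∀ s a s', 0 ≤ P s a s')
    (hP1 : ∀ s a, ∑ s' : S, P s a s' = 1)
    (γ : ℝ) (hγ0 : 0 < γ) (hγ1 : γ < 1)
    (Rmax Vmax : ℝ) (r : S → ℝ) (hr : ∀ s, |r s| ≤ Rmax)
    (hVmax : Vmax = Rmax / (1 - γ))
    (πstar : S → A) (vstar : S → ℝ)
    (hfix : bOp P γ r πstar vstar = vstar)
    (hopt : ∀ (π : S → A) (v : S → ℝ), bOp P γ r π v = v → ∀ s, v s ≤ vstar s)
    (μ ν : S → ℝ) (hμ0 : ∀ s, 0 ≤ μ s) (hμ1 : ∑ s : S, μ s = 1)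
    (hν0 : ∀ s, 0 ≤ ν s) (hν1 : ∑ s : S, ν s = 1)
    (c : ℕ → ℝ) (hc0 : ∀ i, 0 ≤ c i)
    (hc : ∀ (i : ℕ) (πs : ℕ → S → A) (s : S),
      Matrix.vecMul μ (((List.range i).map fun t => polMat P (πs t)).prod) s ≤ c i * ν s)
    (m : ℕ) (hm : 1 ≤ m) (πseq : ℤ → S → A)
    (vN : ℕ → S → ℝ)
    (hvN : ∀ j : ℕ, nsRun P γ r πseq (j : ℤ) m (vN j) = vN j)
    (k : ℕ) (hk : 1 ≤ k)
    (ε : ℝ) (hε : 0 ≤ ε)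
    (herr : ∀ j, 1 ≤ j → j ≤ k →
      (∑ s : S, ν s * errOf P γ r (vN (j - 1)) (πseq (j : ℤ)) s) ≤ ε)
    (hsum : Summable fun p : ℕ × ℕ => γ ^ (p.1 + p.2 * m) * c (p.1 + p.2 * m)) :
    (∑ s : S, μ s * (vstar s - vN k s)) ≤
      (∑' p : ℕ × ℕ, γ ^ (p.1 + p.2 * m) * c (p.1 + p.2 * m)) * ε + 2 * γ ^ k * Vmax := by
  have hV : Rmax + γ * Vmax = Vmax := by
    have : 1 - γ ≠ 0 := by linarith
    rw [hVmax]
    field_simp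
    ring
  have hstar : ∀ s, |vstar s| ≤ Vmax :=
    abs_fixedPoint_nsRun_le hP0 hP1 hγ0 hγ1 hr hV (fun _ => πstar) le_rfl (j := 0)
      (by simpa [nsRun] using hfix)
  have hfac : ∀ l, Summable fun j : ℕ => γ ^ (l + j * m) * c (l + j * m) :=
    fun l => hsum.prod_factor l
  have key : ∀ n ≤ k, ∀ L : List (S → A),
      γ ^ L.length * (μ ⬝ᵥ (polProd P L *ᵥ (vstar - vN n))) ≤
        (∑ i ∈ Finset.range n, ∑' j : ℕ,
          γ ^ (L.length + i + j * m) * c (L.length + i + j * m)) * ε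
          + γ ^ (L.length + n) * (2 * Vmax) := by
    intro n
    induction n with
    | zero =>
      intro _ L
      have hle : vstar - vN 0 ≤ fun _ => 2 * Vmax := fun s => by
        have h₁ := (abs_le.1 (hstar s)).2
        have h₂ := (abs_le.1 (abs_fixedPoint_nsRun_le hP0 hP1 hγ0 hγ1 hr hV πseq hm (hvN 0) s)).1
        simp only [Pi.sub_apply]
        linarith
      have h := dotProduct_polProd_mono hP0 hμ0 L hle
      rw [dotProduct_polProd_const hP1 hμ1] at h
      simpa using mul_le_mul_of_nonneg_left h (by positivity : 0 ≤ γ ^ L.length)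
    | succ n ih =>
      intro hn L
      set e := errOf P γ r (vN n) (πseq ((n + 1 : ℕ) : ℤ)) with he
      set y := bOp P γ r (πseq ((n + 1 : ℕ) : ℤ)) (vN n) - vN (n + 1) + e with hydef
      obtain ⟨L', hL', hy⟩ := nsRun_gap_le (P := P) (γ := γ) (r := r) hP0 hγ0 πseq m
        ((n + 1 : ℕ) : ℤ) (by simpa using hvN n) (hvN (n + 1))
      have hbound := dotProduct_le_of_le_add_smul hP0 hP1 hγ0 hγ1 hμ0 hμ1 hc0 hc hm
        (errOf_nonneg _ _) (by simpa [dotProduct] using herr (n + 1) (by omega) hn)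
        hL' hy L (hfac _)
      have hle : vstar - vN (n + 1) ≤ γ • (polMat P πstar *ᵥ (vstar - vN n)) + y := by
        rw [← bOp_sub (r := r), hfix]
        intro s
        have h := bOp_le_add_errOf (P := P) (γ := γ) (r := r) (vN n)
          (πseq ((n + 1 : ℕ) : ℤ)) πstar s
        simp only [hydef, he, Pi.add_apply, Pi.sub_apply] at h ⊢
        linarith
      have hL : polProd P L * polMat P πstar = polProd P (L ++ [πstar]) := by
        simp [polProd]
      have h := dotProduct_polProd_mono hP0 hμ0 L hle
      rw [Matrix.mulVec_add, dotProduct_add, Matrix.mulVec_smul, dotProduct_smul,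
        Matrix.mulVec_mulVec, hL, smul_eq_mul] at h
      have h₁ := mul_le_mul_of_nonneg_left h (by positivity : 0 ≤ γ ^ L.length)
      have h₂ := ih (by omega) (L ++ [πstar])
      simp only [List.length_append, List.length_singleton] at h₂
      rw [Finset.sum_range_succ']
      have h₃ : ∀ i, L.length + 1 + i = L.length + (i + 1) := fun i => by ring
      rw [add_zero]
      simp only [h₃] at h₂
      rw [pow_succ γ L.length] at h₂
      linarith
  have hmain := key k le_rfl []
  simp only [polProd, List.map_nil, List.prod_nil, Matrix.one_mulVec, List.length_nil, pow_zero,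
    one_mul, zero_add] at hmain
  have hpart : ∑ i ∈ Finset.range k, ∑' j : ℕ, γ ^ (i + j * m) * c (i + j * m) ≤
      ∑' p : ℕ × ℕ, γ ^ (p.1 + p.2 * m) * c (p.1 + p.2 * m) := by
    rw [hsum.tsum_prod]
    exact hsum.prod.sum_le_tsum _ fun i _ =>
      tsum_nonneg fun j => mul_nonneg (by positivity) (hc0 _)
  calc ∑ s : S, μ s * (vstar s - vN k s) = μ ⬝ᵥ (vstar - vN k) := rfl
    _ ≤ _ := hmain
    _ ≤ _ := by
      have := mul_le_mul_of_nonneg_right hpart hε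
      linarith
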